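/- arXiv:2009.00899 — 2 statements merged into one kernel-verified Lean document; each statement's English description precedes it below -/
import Mathlib

section
/- Let ε≥0, η∈[0,1), c>0, w_0>0, and let ρ be a probability measure on ℝ such that ρ([−d,d]∖{0}) ≤ c·d^ε for all d∈[0,1]. Define A:ℝ∖{0}→[0,∞) by A(z) := (2/|z|)^{1−η}. Then there exists a constant c' = c'(ε,η,w_0)>0 such that for all w ≥ w_0 one has ∫_{ℝ∖{0}} min{A(z), w} ρ(dz) ≤ c'·(1∨c)· B(w), where B(w) = w^{1 − ε/(1−η)} if ε+η<1, B(w) = ln(1+w) if ε+η=1, and B(w) = 1 if ε+η>1. -/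
open MeasureTheory Set ENNReal

theorem sb_anal (ε β w₀ : ℝ) (hε : 0 ≤ ε) (hβ : 0 < β) (hw₀ : 0 < w₀) :
    ∃ C : ℝ, 0 < C ∧ ∀ w, w₀ ≤ w → ∀ J : ℝ, ((w < 1 ∧ J = 0) ∨ (1 ≤ w ∧ J = ∫ t in (1:ℝ)..w, t ^ (-(ε/β)))) →
      1 + 2 ^ ε * J ≤ C * (if ε < β then w ^ (1 - ε / β)
                 else if ε = β then Real.log (1 + w) else 1) := by
  have key : ∀ B : ℝ → ℝ, 0 < B w₀ → (∀ w, w₀ ≤ w → B w₀ ≤ B w) → ∀ D : ℝ, 0 < D →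
      (∀ w, w₀ ≤ w → 1 ≤ w → (∫ t in (1:ℝ)..w, t ^ (-(ε/β))) ≤ D * B w) →
      ∃ C : ℝ, 0 < C ∧ ∀ w, w₀ ≤ w → ∀ J : ℝ, ((w < 1 ∧ J = 0) ∨ (1 ≤ w ∧ J = ∫ t in (1:ℝ)..w, t ^ (-(ε/β)))) →
      1 + 2 ^ ε * J ≤ C * B w := by
    intro B hB hm D hD hJ
    have h2 : (0:ℝ) < 2 ^ ε := by positivity
    refine ⟨1 / B w₀ + 2 ^ ε * D, by positivity, fun w hw J h => ?_⟩
    have hBw := hm w hw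
    have h1 : 1 ≤ 1 / B w₀ * B w := by
      rw [one_div, inv_mul_eq_div, le_div_iff₀ hB]; linarith
    have h3 : J ≤ D * B w := by
      rcases h with ⟨_, h⟩ | ⟨h, h'⟩
      · rw [h]; exact mul_nonneg hD.le (hB.le.trans hBw)
      · rw [h']; exact hJ w hw h
    have := mul_le_mul_of_nonneg_left h3 h2.le
    linarith
  have hnot : ∀ w : ℝ, 1 ≤ w → (0:ℝ) ∉ Set.uIcc 1 w := by
    intro w hw h
    rw [Set.uIcc_of_le hw] at h
    linarith [h.1]
  rcases lt_trichotomy ε β with h | h | h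
  · simp only [h, if_true]
    have hp : ε / β < 1 := (div_lt_one hβ).2 h
    refine key (fun w => w ^ (1 - ε / β)) (by positivity) (fun w hw => Real.rpow_le_rpow hw₀.le hw (by linarith)) (1 / (1 - ε/β)) (by apply one_div_pos.2; linarith) ?_
    intro w hw h1
    rw [integral_rpow (Or.inl (by linarith)), Real.one_rpow, one_div, inv_mul_eq_div, neg_add_eq_sub]
    apply div_le_div_of_nonneg_right _ (by linarith)
    linarith
  · subst h
    simp only [lt_irrefl, if_false, if_true]
    refine key (fun w => Real.log (1 + w)) (Real.log_pos (by linarith)) (fun w hw => Real.log_le_log (by linarith) (by linarith)) 1 one_pos ?_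
    intro w hw h1
    have : ε / ε = 1 := div_self hβ.ne'
    simp only [this, Real.rpow_neg_one]
    rw [integral_inv (hnot w h1), div_one, one_mul]
    exact Real.log_le_log (by linarith) (by linarith)
  · simp only [h.not_gt, h.ne', if_false]
    have hp : 1 < ε / β := (one_lt_div hβ).2 h
    refine key (fun w => 1) one_pos (fun _ _ => le_rfl) (1 / (ε/β - 1)) (by apply one_div_pos.2; linarith) ?_
    intro w hw h1
    rw [integral_rpow (Or.inr ⟨by linarith, hnot w h1⟩), Real.one_rpow, mul_one, ← neg_div_neg_eq]
    have e : -(-(ε/β) + 1) = ε/β - 1 := by ring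
    rw [e]
    apply div_le_div_of_nonneg_right _ (by linarith)
    have : 0 ≤ w ^ (-(ε/β) + 1) := Real.rpow_nonneg (by linarith) _
    linarith

theorem sb_tail (ε β c : ℝ) (hε : 0 ≤ ε) (hβ : 0 < β) (hc : 0 < c) (ρ : Measure ℝ)
    [IsProbabilityMeasure ρ]
    (H : ∀ d ∈ Set.Icc (0:ℝ) 1, ρ (Set.Icc (-d) d \ {0}) ≤ ENNReal.ofReal (c * d ^ ε))
    (t : ℝ) (ht : 1 < t) :
    ρ ({z | t ≤ (2 / |z|) ^ β} ∩ {0}ᶜ) ≤ ENNReal.ofReal (max 1 c * 2 ^ ε * t ^ (-(ε/β))) := by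
  have t0 : 0 < t := by linarith
  set d := 2 * t ^ (-(1/β)) with hd
  have d0 : 0 < d := by positivity
  have hde : d ^ ε = 2 ^ ε * t ^ (-(ε/β)) := by
    rw [hd, Real.mul_rpow (by norm_num) (by positivity), ← Real.rpow_mul t0.le]
    congr 2; ring
  rw [mul_assoc, ← hde]
  by_cases h1 : d ≤ 1
  · refine (measure_mono ?_).trans ((H d ⟨d0.le, h1⟩).trans (ENNReal.ofReal_le_ofReal ?_))
    · rintro z ⟨hz, hz0⟩
      refine ⟨?_, hz0⟩
      have hz1 : 0 < |z| := abs_pos.2 hz0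
      rw [mem_Icc, ← abs_le]
      have h2 : t ^ (1/β) ≤ 2 / |z| := by
        have := Real.rpow_le_rpow t0.le hz (by positivity : 0 ≤ 1/β)
        rwa [← Real.rpow_mul (by positivity), mul_one_div_cancel hβ.ne', Real.rpow_one] at this
      rw [hd, Real.rpow_neg t0.le, ← div_eq_mul_inv]
      have h3 : 0 < t ^ (1/β) := by positivity
      rw [le_div_iff₀ hz1] at h2
      rw [le_div_iff₀ h3]; linarith
    · exact mul_le_mul_of_nonneg_right (le_max_right _ _) (by positivity)
  · refine prob_le_one.trans ?_
    rw [← ENNReal.ofReal_one]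
    apply ENNReal.ofReal_le_ofReal
    have : 1 ≤ d ^ ε := Real.one_le_rpow (not_le.1 h1).le hε
    exact one_le_mul_of_one_le_of_one_le (le_max_left _ _) this

theorem sb_layer (ε β c w : ℝ) (hε : 0 ≤ ε) (hβ : 0 < β) (hc : 0 < c) (hw : 0 < w) (ρ : Measure ℝ)
    [IsProbabilityMeasure ρ]
    (H : ∀ d ∈ Set.Icc (0:ℝ) 1, ρ (Set.Icc (-d) d \ {0}) ≤ ENNReal.ofReal (c * d ^ ε)) :
    ∃ J : ℝ, ((w < 1 ∧ J = 0) ∨ (1 ≤ w ∧ J = ∫ t in (1:ℝ)..w, t ^ (-(ε/β)))) ∧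
    (∫⁻ z in ({0}ᶜ : Set ℝ), ENNReal.ofReal (min ((2 / |z|) ^ β) w) ∂ρ)
      ≤ ENNReal.ofReal (max 1 c * (1 + 2 ^ ε * J)) := by
  have hms : MeasurableSet ({0}ᶜ : Set ℝ) := (measurableSet_singleton 0).compl
  by_cases h1 : w < 1
  · refine ⟨0, Or.inl ⟨h1, rfl⟩, ?_⟩
    calc _ ≤ ∫⁻ z in ({0}ᶜ : Set ℝ), 1 ∂ρ := by
            apply lintegral_mono
            intro z
            simp only
            rw [← ENNReal.ofReal_one]
            exact ENNReal.ofReal_le_ofReal ((min_le_right _ _).trans h1.le)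
      _ ≤ 1 := by
            rw [lintegral_const, one_mul, Measure.restrict_apply_univ]; exact prob_le_one
      _ ≤ _ := by
            rw [← ENNReal.ofReal_one]
            apply ENNReal.ofReal_le_ofReal
            simp
  · rw [not_lt] at h1
    refine ⟨_, Or.inr ⟨h1, rfl⟩, ?_⟩
    have hmeas : Measurable (fun z : ℝ => min ((2 / |z|) ^ β) w) := by fun_prop
    rw [lintegral_eq_lintegral_meas_le _ (Filter.Eventually.of_forall fun z => by
      simp only [Pi.zero_apply]; positivity) hmeas.aemeasurable]
    have hbd : ∀ t ∈ Ioi (0:ℝ), (ρ.restrict {0}ᶜ) {z | t ≤ min ((2 / |z|) ^ β) w} ≤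
        (Ioc (0:ℝ) 1).indicator 1 t + (Ioc (1:ℝ) w).indicator (fun t => ENNReal.ofReal (max 1 c * 2 ^ ε * t ^ (-(ε/β)))) t := by
      intro t ht
      rw [Measure.restrict_apply' hms]
      by_cases ht1 : t ≤ 1
      · rw [indicator_of_mem (show t ∈ Ioc (0:ℝ) 1 from ⟨ht, ht1⟩)]
        exact prob_le_one.trans le_self_add
      · rw [not_le] at ht1
        by_cases htw : t ≤ w
        · rw [indicator_of_mem (show t ∈ Ioc 1 w from ⟨ht1, htw⟩)]
          refine le_trans (measure_mono ?_) ((sb_tail ε β c hε hβ hc ρ H t ht1).trans le_add_self)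
          rintro z ⟨hz, hz0⟩
          have hz' : t ≤ min ((2 / |z|) ^ β) w := hz
          exact ⟨hz'.trans (min_le_left _ _), hz0⟩
        · have : {z : ℝ | t ≤ min ((2 / |z|) ^ β) w} = ∅ := by
            ext z; simp [htw]
          rw [this, empty_inter, measure_empty]
          exact zero_le
    refine (setLIntegral_mono' measurableSet_Ioi hbd).trans ?_
    refine (setLIntegral_le_lintegral _ _).trans ?_
    rw [lintegral_add_left (measurable_one.indicator measurableSet_Ioc),
      lintegral_indicator measurableSet_Ioc, lintegral_indicator measurableSet_Ioc]
    have hint : IntervalIntegrable (fun t : ℝ => max 1 c * 2 ^ ε * t ^ (-(ε/β))) volume 1 w := by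
      apply IntervalIntegrable.const_mul
      apply intervalIntegral.intervalIntegrable_rpow
      right
      rw [Set.uIcc_of_le h1]
      intro h; linarith [h.1]
    rw [← ofReal_integral_eq_lintegral_ofReal ((intervalIntegrable_iff_integrableOn_Ioc_of_le h1).1 hint)
      ((ae_restrict_iff' measurableSet_Ioc).2 (Filter.Eventually.of_forall fun t ht => by
        have : 0 < t := by linarith [ht.1]
        simp only [Pi.zero_apply]; positivity)),
      ← intervalIntegral.integral_of_le h1, intervalIntegral.integral_const_mul]
    have hJ : 0 ≤ ∫ t in (1:ℝ)..w, t ^ (-(ε/β)) :=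
      intervalIntegral.integral_nonneg h1 fun t ht => Real.rpow_nonneg (by linarith [ht.1]) _
    have e1 : ∫⁻ (a : ℝ) in Ioc 0 1, (1 : ℝ → ℝ≥0∞) a = ENNReal.ofReal 1 := by simp
    rw [e1, ← ENNReal.ofReal_add zero_le_one (by positivity)]
    apply ENNReal.ofReal_le_ofReal
    have := le_max_left 1 c
    linarith


/-- Small-ball estimate: if `ρ([−d,d]∖{0}) ≤ c d^ε` for `d ∈ [0,1]` and
`A(z) := (2/|z|)^{1−η}`, then there is a `c' = c'(ε,η,w₀) > 0` (independent of `c` and `ρ`)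
such that for all `w ≥ w₀`,
`∫_{ℝ∖{0}} min{A(z), w} ρ(dz) ≤ c' (1∨c) B(w)` with `B(w) = w^{1−ε/(1−η)}` if `ε+η<1`,
`B(w) = ln(1+w)` if `ε+η=1`, and `B(w) = 1` if `ε+η>1`. -/
theorem smallBall_truncated_integral_bound
    (ε η w₀ : ℝ) (hε : 0 ≤ ε) (hη : η ∈ Set.Ico (0:ℝ) 1) (hw₀ : 0 < w₀) :
    ∃ c' : ℝ, 0 < c' ∧
      ∀ c : ℝ, 0 < c → ∀ ρ : Measure ℝ, IsProbabilityMeasure ρ →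
        (∀ d ∈ Set.Icc (0:ℝ) 1, ρ (Set.Icc (-d) d \ {0}) ≤ ENNReal.ofReal (c * d ^ ε)) →
        ∀ w : ℝ, w₀ ≤ w →
          (∫⁻ z in ({0}ᶜ : Set ℝ), ENNReal.ofReal (min ((2 / |z|) ^ (1 - η)) w) ∂ρ)
            ≤ ENNReal.ofReal (c' * max 1 c *
                (if ε + η < 1 then w ^ (1 - ε / (1 - η))
                 else if ε + η = 1 then Real.log (1 + w) else 1)) := by
  have hβ : 0 < 1 - η := by linarith [hη.2]
  obtain ⟨C, hC, h⟩ := sb_anal ε (1 - η) w₀ hε hβ hw₀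
  refine ⟨C, hC, fun c hc ρ hρ H w hw => ?_⟩
  obtain ⟨J, hJ, hb⟩ := sb_layer ε (1 - η) c w hε hβ hc (hw₀.trans_le hw) ρ H
  refine hb.trans (ENNReal.ofReal_le_ofReal ?_)
  have h' := h w hw J hJ
  have i1 : (ε + η < 1) = (ε < 1 - η) := by rw [lt_sub_iff_add_lt]
  have i2 : (ε + η = 1) = (ε = 1 - η) := by rw [eq_sub_iff_add_eq]
  simp only [i1, i2]
  rw [mul_comm C, mul_assoc]
  exact mul_le_mul_of_nonneg_left h' (by positivity)
end

section
/- Let η∈[0,1], let f:ℝ→ℝ satisfy |f(x)−f(y)| ≤ |f|_η |x−y|^η for all x,y∈ℝ and some constant |f|_η ≥ 0, let σ>0 and s>0, let G be a centered Gaussian random variable with variance s, and let J be a real random variable independent of G. Fix x∈ℝ and assume that f(x+σG+J)·G and f(x+J) are integrable. Then | E[ f(x + σG + J) · G ] | ≤ |f|_η · σ^η · s^{(η+1)/2} · m_{η+1}, where m_{η+1} := ∫_ℝ |u|^{η+1} e^{−u²/2} du/√(2π) is the (η+1)-st absolute moment of a standard Gaussian. Equivalently, |E[f(x+σG+J)·G/s]|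 ≤ |f|_η σ^{η} s^{(η−1)/2} m_{η+1}. -/
open MeasureTheory Set ENNReal NNReal ProbabilityTheory

lemma aux_moment (p : ℝ) (s : ℝ≥0) :
    ∫ u, |u| ^ p ∂(gaussianReal 0 s) = (s : ℝ) ^ (p / 2) *
      ((∫ u : ℝ, |u| ^ p * Real.exp (-(u ^ 2) / 2)) / Real.sqrt (2 * Real.pi)) := by
  have h1 : gaussianReal 0 s = (gaussianReal 0 1).map (fun u => Real.sqrt s * u) := by
    rw [gaussianReal_map_const_mul]
    congr 1
    · simp
    · ext; simp
  have hm : Measurable (fun u : ℝ => |u| ^ p) := by fun_prop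
  rw [h1, integral_map (by fun_prop) hm.aestronglyMeasurable]
  have h2 : ∀ u : ℝ, |Real.sqrt s * u| ^ p = (s : ℝ) ^ (p / 2) * |u| ^ p := by
    intro u
    rw [abs_mul, Real.mul_rpow (abs_nonneg _) (abs_nonneg _), abs_of_nonneg (Real.sqrt_nonneg _),
      Real.sqrt_eq_rpow, ← Real.rpow_mul (NNReal.coe_nonneg s)]
    congr 2
    ring
  simp_rw [h2]
  rw [integral_const_mul, integral_gaussianReal_eq_integral_smul (by simp)]
  congr 1
  rw [div_eq_mul_inv, ← integral_mul_const]
  congr 1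
  ext u
  simp [gaussianPDFReal]
  ring

lemma aux_cont (η : ℝ) (hη : 0 < η) (f : ℝ → ℝ) (Cf : ℝ)
    (hf : ∀ x y : ℝ, |f x - f y| ≤ Cf * |x - y| ^ η) : Continuous f := by
  rw [continuous_iff_continuousAt]
  intro a
  rw [ContinuousAt, tendsto_iff_dist_tendsto_zero]
  refine squeeze_zero (fun _ => dist_nonneg) (fun y => hf y a) ?_
  have : Continuous (fun y : ℝ => Cf * |y - a| ^ η) :=
    continuous_const.mul (Continuous.rpow_const (by fun_prop) (fun _ => Or.inr hη.le))
  have h := this.tendsto a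
  simpa [Real.zero_rpow hη.ne'] using h


/-- Gaussian moment estimate behind the gradient bound on the Wiener part: if `f` is
`η`-Hölder with constant `Cf`, `G ~ N(0,s)` and `J` is independent of `G`, then
`|E[f(x + σG + J) G]| ≤ Cf σ^η s^{(η+1)/2} m_{η+1}`, where
`m_{η+1} = ∫_ℝ |u|^{η+1} e^{−u²/2} du/√(2π)` is the `(η+1)`-st absolute moment of a
standard Gaussian. -/
theorem gaussian_gradient_moment_bound
    {Ω : Type*} {mΩ : MeasurableSpace Ω} (P : Measure Ω) [IsProbabilityMeasure P]
    (η : ℝ) (hη : η ∈ Set.Icc (0:ℝ) 1)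
    (f : ℝ → ℝ) (Cf : ℝ) (hCf : 0 ≤ Cf)
    (hf : ∀ x y : ℝ, |f x - f y| ≤ Cf * |x - y| ^ η)
    (σ : ℝ) (hσ : 0 < σ) (s : ℝ≥0) (hs : 0 < s)
    (G J : Ω → ℝ) (hG : Measurable G) (hJ : Measurable J)
    (hGlaw : Measure.map G P = ProbabilityTheory.gaussianReal 0 s)
    (hindep : ProbabilityTheory.IndepFun G J P)
    (x : ℝ)
    (hint1 : Integrable (fun ω => f (x + σ * G ω + J ω) * G ω) P)
    (hint2 : Integrable (fun ω => f (x + J ω)) P) :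
    |∫ ω, f (x + σ * G ω + J ω) * G ω ∂P|
      ≤ Cf * σ ^ η * (s : ℝ) ^ ((η + 1) / 2) *
        ((∫ u : ℝ, |u| ^ (η + 1) * Real.exp (-(u ^ 2) / 2)) / Real.sqrt (2 * Real.pi)) := by
  have hGL : MemLp G 1 P := by
    have := memLp_id_gaussianReal (μ := 0) (v := s) 1
    rw [← hGlaw, memLp_map_measure_iff (by fun_prop) hG.aemeasurable] at this
    simpa using this
  have hGi : Integrable G P := memLp_one_iff_integrable.1 hGL
  have hG0 : ∫ ω, G ω ∂P = 0 := by
    have h : ∫ u, u ∂(Measure.map G P) = 0 := by rw [hGlaw]; simp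
    rwa [integral_map hG.aemeasurable (by fun_prop)] at h
  have hp : (0:ℝ) < η + 1 := by linarith [hη.1]
  have hmi : Integrable (fun ω => |G ω| ^ (η + 1)) P := by
    have h := (memLp_id_gaussianReal (μ := 0) (v := s) (Real.toNNReal (η + 1))).integrable_norm_rpow
      (by simpa using hp) (by simp)
    rw [← hGlaw] at h
    have h' := h.comp_measurable hG
    simpa [Function.comp_def, max_eq_left hp.le] using h'
  have hmom : ∫ ω, |G ω| ^ (η + 1) ∂P = (s : ℝ) ^ ((η + 1) / 2) *
        ((∫ u : ℝ, |u| ^ (η + 1) * Real.exp (-(u ^ 2) / 2)) / Real.sqrt (2 * Real.pi)) := by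
    rw [← aux_moment, ← hGlaw, integral_map hG.aemeasurable]
    exact Measurable.aestronglyMeasurable (by fun_prop)
  obtain ⟨c, hci, hc0, hcb⟩ : ∃ c : Ω → ℝ, Integrable (fun ω => c ω * G ω) P ∧
      ∫ ω, c ω * G ω ∂P = 0 ∧
      ∀ ω, |f (x + σ * G ω + J ω) - c ω| ≤ Cf * (σ * |G ω|) ^ η := by
    rcases hη.1.eq_or_lt with h0 | h0
    · subst h0
      refine ⟨fun _ => f 0, hGi.const_mul _, by rw [integral_const_mul, hG0, mul_zero], ?_⟩
      intro ω
      simpa using hf (x + σ * G ω + J ω) 0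
    · have hfc := aux_cont η h0 f Cf hf
      have hi : IndepFun (fun ω => f (x + J ω)) G P :=
        hindep.symm.comp (φ := fun j => f (x + j)) (ψ := id)
          (hfc.comp (by fun_prop)).measurable measurable_id
      refine ⟨fun ω => f (x + J ω), hi.integrable_mul hint2 hGi, ?_, ?_⟩
      · have := hi.integral_mul_eq_mul_integral hint2.aestronglyMeasurable hGi.aestronglyMeasurable
        simpa [hG0] using this
      · intro ω
        have := hf (x + σ * G ω + J ω) (x + J ω)
        rwa [show x + σ * G ω + J ω - (x + J ω) = σ * G ω by ring, abs_mul, abs_of_pos hσ] at this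
  have hkey : ∫ ω, f (x + σ * G ω + J ω) * G ω ∂P =
      ∫ ω, (f (x + σ * G ω + J ω) * G ω - c ω * G ω) ∂P := by
    rw [integral_sub hint1 hci, hc0, sub_zero]
  rw [hkey, mul_assoc (Cf * σ ^ η), ← hmom, ← integral_const_mul, ← Real.norm_eq_abs]
  refine norm_integral_le_of_norm_le (hmi.const_mul _) (Filter.Eventually.of_forall fun ω => ?_)
  rw [← sub_mul, norm_mul, Real.norm_eq_abs, Real.norm_eq_abs]
  calc _ ≤ Cf * (σ * |G ω|) ^ η * |G ω| := by gcongr; exact hcb ω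
    _ = _ := by
      rw [Real.mul_rpow hσ.le (abs_nonneg _),
        Real.rpow_add_of_nonneg (abs_nonneg _) hη.1 zero_le_one, Real.rpow_one]
      ring
end
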